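/- arXiv:2307.06638 — 5 statements merged into one kernel-verified Lean document; each statement's English description precedes it below -/
import Mathlib

section
/- Let $R$ be a commutative ring and $a,b \in R$. Suppose $u,v,u',v' \in R$ satisfy $a u^2 + b v^2 = 1$ and $a u'^2 + b v'^2 = 1$. Set $x_0 = a u u' + b v v'$ and $x_1 = v u' - u v'$. Then $x_0^2 + a b x_1^2 = 1$, $u x_0 + b v x_1 = u'$, and $v x_0 - a u x_1 = v'$. -/
/-- Transitivity of the norm-one torus action on the conic `a x² + b y² = 1`:
an explicit torus element carrying `(u, v)` to `(u', v')`. -/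
theorem stmt_1 (R : Type*) [CommRing R] (a b u v u' v' : R)
    (h : a * u ^ 2 + b * v ^ 2 = 1) (h' : a * u' ^ 2 + b * v' ^ 2 = 1) :
    (a * u * u' + b * v * v') ^ 2 + a * b * (v * u' - u * v') ^ 2 = 1 ∧
    u * (a * u * u' + b * v * v') + b * v * (v * u' - u * v') = u' ∧
    v * (a * u * u' + b * v * v') - a * u * (v * u' - u * v') = v' := by
  refine ⟨?_, ?_, ?_⟩
  · linear_combination (a * u' ^ 2 + b * v' ^ 2) * h + h'
  · linear_combination u' * h
  · linear_combination v' * h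
end

section
/- Let $R$ be a commutative ring and $a,b \in R$. Suppose $u,v,x_0,x_1 \in R$ satisfy $a u^2 + b v^2 = 1$, $u x_0 + b v x_1 = u$, and $v x_0 - a u x_1 = v$. Then $x_0 = 1$ and $x_1 = 0$. -/
/-- Freeness of the norm-one torus action on points of the conic `a x² + b y² = 1`. -/
theorem stmt_2 (R : Type*) [CommRing R] (a b u v x₀ x₁ : R)
    (h : a * u ^ 2 + b * v ^ 2 = 1)
    (h₁ : u * x₀ + b * v * x₁ = u) (h₂ : v * x₀ - a * u * x₁ = v) :
    x₀ = 1 ∧ x₁ = 0 := by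
  constructor
  · linear_combination a * u * h₁ + b * v * h₂ - (x₀ - 1) * h
  · linear_combination v * h₁ - u * h₂ - x₁ * h
end

section
/- Let $p$ be an odd prime, let $u \in \mathbb{Z}_p$ be a unit, and let $f \in \mathbb{Z}_p$ with $p \mid f$. Then there exist $x, y \in \mathbb{Z}_p$ with $u x^2 + f y^2 = 1$ if and only if $u$ is a square in $\mathbb{Z}_p$. -/
/-- For odd `p`, a `p`-adic integer congruent to `1` modulo `p` is a square. -/
theorem PadicInt.isSquare_of_dvd_sub_one {p : ℕ} [Fact p.Prime] (hp : p ≠ 2) {w : ℤ_[p]}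
    (hw : (p : ℤ_[p]) ∣ w - 1) : IsSquare w := by
  have h_two : ‖(2 : ℤ_[p])‖ = 1 := by
    have h := (PadicInt.norm_natCast_eq_one_iff (p := p) (n := 2)).2
      ((Nat.coprime_primes Fact.out Nat.prime_two).2 hp)
    exact_mod_cast h
  have h_lt : ‖1 - w‖ < 1 := by
    rw [norm_sub_rev]
    exact (PadicInt.norm_lt_one_iff_dvd _).2 hw
  obtain ⟨z, hz, -⟩ := hensels_lemma (F := Polynomial.X ^ 2 - Polynomial.C w) (a := (1 : ℤ_[p]))
    (by simpa [one_add_one_eq_two, h_two] using h_lt)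
  refine ⟨z, ?_⟩
  have h_root : z ^ 2 - w = 0 := by simpa using hz
  linear_combination -h_root

/-- Hensel-lemma criterion for integral local solubility of the degenerate conic
`u x² + f y² = 1` over `ℤ_p`, `p` odd, `u` a unit and `p ∣ f`. -/
theorem stmt_4 (p : ℕ) [Fact p.Prime] (hp : p ≠ 2) (u f : ℤ_[p])
    (hu : IsUnit u) (hf : (p : ℤ_[p]) ∣ f) :
    (∃ x y : ℤ_[p], u * x ^ 2 + f * y ^ 2 = 1) ↔ IsSquare u := by
  constructor
  · rintro ⟨x, y, h⟩
    have h_dvd : (p : ℤ_[p]) ∣ u * x ^ 2 - 1 := by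
      rw [show u * x ^ 2 - 1 = f * -y ^ 2 by linear_combination h]
      exact hf.mul_right _
    obtain ⟨s, hs⟩ := PadicInt.isSquare_of_dvd_sub_one hp h_dvd
    have hx : IsUnit x := by
      by_contra hx
      have hpx : (p : ℤ_[p]) ∣ x :=
        (PadicInt.norm_lt_one_iff_dvd x).1 (PadicInt.mem_nonunits.1 hx)
      have hp_one : (p : ℤ_[p]) ∣ 1 :=
        h ▸ ((hpx.pow two_ne_zero).mul_left u).add (hf.mul_right _)
      exact PadicInt.prime_p.not_dvd_one hp_one
    obtain ⟨v, hv⟩ := hx.exists_right_inv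
    exact ⟨s * v, by linear_combination v ^ 2 * hs - u * (x * v + 1) * hv⟩
  · rintro ⟨r, rfl⟩
    obtain ⟨v, hv⟩ := (isUnit_of_mul_isUnit_left hu).exists_right_inv
    exact ⟨v, 0, by linear_combination (r * v + 1) * hv⟩
end

section
/- Fix a finite index set $J$, integers $c_i, d_i$ for $i \in J$ with $c_i$ and $d_i$ coprime, set $p_i(t) = c_i t + d_i$ and $\Delta_{i,j} = c_i d_j - c_j d_i$, and assume $\Delta_{i,j} \neq 0$ for $i \neq j$. Fix a partition $J = A \cup B$ and nonzero integers $a, b$, and write $p_{J'}(t) = \prod_{j \in J'} p_j(t)$ for $J' \subseteq J$. Let $p$ be an odd prime dividing neither $a$, nor $b$, nor any $\Delta_{i,j}$ with $i \neq j$. Let $t \in \mathbb{Z}_p$ and $i \in J$ be such that $p \mid p_i(t)$ in $\mathbb{Z}_p$. Then $c_i$ is a unit in $\mathbb{Z}_p$, and setting $\tau_i = -d_i/c_i \in \mathbb{Z}_p$: if $i \notin A$, there exist $x,y \in \mathbb{Z}_p$ with $a\,p_A(t)\,x^2 + b\,p_B(t)\,y^2 = 1$ if and only if $a\,p_A(\tau_i)$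 is a square in $\mathbb{Z}_p$; and if $i \in A$, such $x,y$ exist if and only if $b\,p_B(\tau_i)$ is a square in $\mathbb{Z}_p$. -/
/-- A `p`-adic integer is a unit iff it is not divisible by `p`. -/
theorem PadicInt.isUnit_iff_not_dvd {p : ℕ} [Fact p.Prime] {u : ℤ_[p]} :
    IsUnit u ↔ ¬ (p : ℤ_[p]) ∣ u := by
  rw [← PadicInt.norm_lt_one_iff_dvd, PadicInt.isUnit_iff, not_lt]
  exact ⟨fun h => h.ge, fun h => le_antisymm (PadicInt.norm_le_one u) h⟩

/-- For odd `p`, a `p`-adic unit congruent to a square modulo `p` is a square. -/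
theorem PadicInt.isSquare_of_dvd_sub_sq {p : ℕ} [Fact p.Prime] (hp2 : p ≠ 2) {u s : ℤ_[p]}
    (hu : IsUnit u) (h : (p : ℤ_[p]) ∣ u - s ^ 2) : IsSquare u := by
  have hs : IsUnit s := by
    rw [PadicInt.isUnit_iff_not_dvd] at hu ⊢
    intro hs
    exact hu ((dvd_sub_left (dvd_pow hs two_ne_zero)).mp h)
  have h2 : IsUnit (2 : ℤ_[p]) := by
    rw [PadicInt.isUnit_iff_not_dvd, ← PadicInt.norm_lt_one_iff_dvd]
    intro h2
    have h2' : (p : ℤ) ∣ 2 := by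
      rw [← PadicInt.norm_int_lt_one_iff_dvd]
      exact_mod_cast h2
    exact hp2 ((Nat.prime_dvd_prime_iff_eq Fact.out Nat.prime_two).mp (by exact_mod_cast h2'))
  have hder : ‖2 * s‖ = 1 := PadicInt.isUnit_iff.mp (h2.mul hs)
  have hval : ‖s ^ 2 - u‖ < 1 := by
    rw [PadicInt.norm_lt_one_iff_dvd, dvd_sub_comm]
    exact h
  obtain ⟨z, hz, -⟩ := hensels_lemma (p := p)
    (F := (Polynomial.X ^ 2 - Polynomial.C u : Polynomial ℤ_[p])) (a := s) (by
      simpa [one_add_one_eq_two, hder] using hval)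
  refine ⟨z, ?_⟩
  simp only [map_sub, map_pow, Polynomial.aeval_X, Polynomial.aeval_C, Algebra.algebraMap_self,
    RingHom.id_apply] at hz
  linear_combination -hz

/-- If `p` is odd, `p ∣ v` and `u` is congruent modulo `p` to a unit `w`, then
`u x² + v y² = 1` is soluble in `ℤ_[p]` iff `w` is a square. -/
theorem PadicInt.exists_mul_sq_add_mul_sq_eq_one_iff {p : ℕ} [Fact p.Prime] (hp2 : p ≠ 2)
    {u v w : ℤ_[p]} (hv : (p : ℤ_[p]) ∣ v) (hw : IsUnit w) (huw : (p : ℤ_[p]) ∣ u - w) :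
    (∃ x y : ℤ_[p], u * x ^ 2 + v * y ^ 2 = 1) ↔ IsSquare w := by
  constructor
  · rintro ⟨x, y, h⟩
    have hx : IsUnit x := by
      rw [PadicInt.isUnit_iff_not_dvd]
      intro hx
      refine (PadicInt.prime_p (p := p)).not_dvd_one ?_
      rw [← h]
      exact dvd_add (dvd_mul_of_dvd_right (dvd_pow hx two_ne_zero) u) (dvd_mul_of_dvd_left hv _)
    obtain ⟨z, hz⟩ := hx.exists_right_inv
    refine PadicInt.isSquare_of_dvd_sub_sq hp2 (s := z) hw ?_
    have key : w - z ^ 2 = -(v * (y ^ 2 * z ^ 2) + (u - w)) := by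
      linear_combination z ^ 2 * h - u * (x * z + 1) * hz
    rw [key]
    exact (dvd_add (dvd_mul_of_dvd_left hv _) huw).neg_right
  · rintro ⟨s, rfl⟩
    have hu : IsUnit u := by
      rw [PadicInt.isUnit_iff_not_dvd] at hw ⊢
      exact fun h => hw ((dvd_sub_right h).mp huw)
    obtain ⟨r, rfl⟩ := PadicInt.isSquare_of_dvd_sub_sq hp2 (s := s) hu (by rwa [sq])
    obtain ⟨z, hz⟩ := hu.exists_right_inv
    exact ⟨r * z, 0, by linear_combination (r * r * z + 1) * hz⟩

/-- An integer not divisible by `p` is a `p`-adic unit. -/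
theorem PadicInt.isUnit_intCast_of_not_dvd {p : ℕ} [Fact p.Prime] {n : ℤ}
    (h : ¬ (p : ℤ) ∣ n) : IsUnit (n : ℤ_[p]) := by
  rw [PadicInt.isUnit_iff_not_dvd, ← PadicInt.norm_lt_one_iff_dvd,
    PadicInt.norm_int_lt_one_iff_dvd]
  exact h

/-- A product of linear polynomials respects congruences between its arguments. -/
theorem Finset.dvd_prod_linear_sub_prod_linear {R ι : Type*} [CommRing R] (S : Finset ι)
    (c d : ι → R) {q t τ : R} (h : q ∣ t - τ) :
    q ∣ ∏ j ∈ S, (c j * t + d j) - ∏ j ∈ S, (c j * τ + d j) := by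
  rw [← Ideal.mem_span_singleton, ← Ideal.Quotient.eq] at h ⊢
  simp [h]


/-- Locally soluble fibres: if `p` is an odd prime of good reduction and the fibre of
`a p_A(t) x² + b p_B(t) y² = 1` lies over a `t` with `p ∣ p_i(t)`, then `c i` is a
`p`-adic unit and the fibre has a `ℤ_p`-point iff the relevant coefficient evaluated at
`τ_i = -d_i / c_i` is a square in `ℤ_p`. -/
theorem stmt_5 (J : Type*) [Fintype J] [DecidableEq J] (c d : J → ℤ)
    (hcop : ∀ i, IsCoprime (c i) (d i))
    (hΔ : ∀ i j, i ≠ j → c i * d j - c j * d i ≠ 0)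
    (A : Finset J) (a b : ℤ) (ha : a ≠ 0) (hb : b ≠ 0)
    (p : ℕ) [Fact p.Prime] (hp2 : p ≠ 2)
    (hpa : ¬ (p : ℤ) ∣ a) (hpb : ¬ (p : ℤ) ∣ b)
    (hpΔ : ∀ i j, i ≠ j → ¬ (p : ℤ) ∣ (c i * d j - c j * d i))
    (t : ℤ_[p]) (i : J)
    (hi : (p : ℤ_[p]) ∣ ((c i : ℤ_[p]) * t + (d i : ℤ_[p]))) :
    IsUnit ((c i : ℤ_[p])) ∧
    (letI τ : ℤ_[p] := -(d i : ℤ_[p]) * Ring.inverse (c i : ℤ_[p])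
     (i ∉ A →
       ((∃ x y : ℤ_[p],
           (a : ℤ_[p]) * (∏ j ∈ A, ((c j : ℤ_[p]) * t + (d j : ℤ_[p]))) * x ^ 2 +
           (b : ℤ_[p]) * (∏ j ∈ Aᶜ, ((c j : ℤ_[p]) * t + (d j : ℤ_[p]))) * y ^ 2 = 1) ↔
         IsSquare ((a : ℤ_[p]) * ∏ j ∈ A, ((c j : ℤ_[p]) * τ + (d j : ℤ_[p]))))) ∧
     (i ∈ A →
       ((∃ x y : ℤ_[p],
           (a : ℤ_[p]) * (∏ j ∈ A, ((c j : ℤ_[p]) * t + (d j : ℤ_[p]))) * x ^ 2 +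
           (b : ℤ_[p]) * (∏ j ∈ Aᶜ, ((c j : ℤ_[p]) * t + (d j : ℤ_[p]))) * y ^ 2 = 1) ↔
         IsSquare ((b : ℤ_[p]) * ∏ j ∈ Aᶜ, ((c j : ℤ_[p]) * τ + (d j : ℤ_[p])))))) := by
  have hc : IsUnit (c i : ℤ_[p]) := by
    refine PadicInt.isUnit_intCast_of_not_dvd fun h => ?_
    have hcp : (p : ℤ_[p]) ∣ (c i : ℤ_[p]) := by
      simpa using map_dvd (Int.castRingHom ℤ_[p]) h
    have hdp : (p : ℤ_[p]) ∣ (d i : ℤ_[p]) :=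
      (dvd_add_right (dvd_mul_of_dvd_left hcp t)).mp hi
    obtain ⟨r, s, hrs⟩ := hcop i
    refine (PadicInt.prime_p (p := p)).not_dvd_one ?_
    have hrs' : (r : ℤ_[p]) * c i + s * d i = 1 := by exact_mod_cast hrs
    rw [← hrs']
    exact dvd_add (dvd_mul_of_dvd_right hcp _) (dvd_mul_of_dvd_right hdp _)
  refine ⟨hc, ?_⟩
  set τ : ℤ_[p] := -(d i : ℤ_[p]) * Ring.inverse (c i : ℤ_[p]) with τ_def
  have hτ : (c i : ℤ_[p]) * τ = -(d i : ℤ_[p]) := by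
    rw [τ_def]
    linear_combination (-(d i : ℤ_[p])) * Ring.mul_inverse_cancel _ hc
  have htτ : (p : ℤ_[p]) ∣ t - τ := by
    rw [← hc.dvd_mul_left]
    convert hi using 1
    linear_combination -hτ
  have hunit (e : ℤ) (he : ¬ (p : ℤ) ∣ e) (S : Finset J) (hS : i ∉ S) :
      IsUnit ((e : ℤ_[p]) * ∏ j ∈ S, ((c j : ℤ_[p]) * τ + (d j : ℤ_[p]))) := by
    refine (PadicInt.isUnit_intCast_of_not_dvd he).mul ?_
    rw [IsUnit.prod_iff]
    intro j hj
    have hij : i ≠ j := fun h => hS (h ▸ hj)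
    refine isUnit_of_mul_isUnit_right (x := (c i : ℤ_[p])) ?_
    convert PadicInt.isUnit_intCast_of_not_dvd (hpΔ i j hij) using 1
    push_cast
    linear_combination (c j : ℤ_[p]) * hτ
  have hcongr (e : ℤ) (S : Finset J) :
      (p : ℤ_[p]) ∣ (e : ℤ_[p]) * ∏ j ∈ S, ((c j : ℤ_[p]) * t + (d j : ℤ_[p])) -
        (e : ℤ_[p]) * ∏ j ∈ S, ((c j : ℤ_[p]) * τ + (d j : ℤ_[p])) := by
    rw [← mul_sub]
    exact dvd_mul_of_dvd_right (S.dvd_prod_linear_sub_prod_linear _ _ htτ) _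
  have hdvd (e : ℤ) (S : Finset J) (hS : i ∈ S) :
      (p : ℤ_[p]) ∣ (e : ℤ_[p]) * ∏ j ∈ S, ((c j : ℤ_[p]) * t + (d j : ℤ_[p])) :=
    dvd_mul_of_dvd_right (hi.trans
      (Finset.dvd_prod_of_mem (fun j => (c j : ℤ_[p]) * t + (d j : ℤ_[p])) hS)) _
  constructor
  · intro hA
    exact PadicInt.exists_mul_sq_add_mul_sq_eq_one_iff hp2
      (hdvd b Aᶜ (Finset.mem_compl.mpr hA)) (hunit a hpa A hA) (hcongr a A)
  · intro hA
    rw [← PadicInt.exists_mul_sq_add_mul_sq_eq_one_iff hp2 (hdvd a A hA)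
      (hunit b hpb Aᶜ (by simpa using hA)) (hcongr b Aᶜ), exists_comm]
    simp only [add_comm]
end

section
/- Let $m, n_1, n_2$ be squarefree integers (possibly negative) such that $n_1 \notin \{1, m\}$ and $n_2 \notin \{1, m\}$. Then there exist infinitely many primes $w$ not dividing $2\,m\,n_1\,n_2$ such that $m$ is a square modulo $w$ while neither $n_1$ nor $n_2$ is a square modulo $w$. -/
open scoped NumberTheorySymbols

/-- A squarefree integer other than `1` is a non-residue, in the sense of the Jacobi symbol, at
arbitrarily large primes. -/
lemma exists_prime_gt_jacobiSym_eq_neg_one_of_squarefree {d : ℤ} (hd : Squarefree d) (h1 : d ≠ 1)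
    (B : ℕ) : ∃ p : ℕ, B < p ∧ p.Prime ∧ J(d | p) = -1 := by
  have hd' : Squarefree d.natAbs := Int.squarefree_natAbs.mpr hd
  rcases Nat.eq_two_pow_or_exists_odd_prime_and_dvd d.natAbs with ⟨k, hk⟩ | ⟨q, hq, hqd, hqo⟩
  · have key : ∀ a : ℕ, a.Coprime 8 → J(d | a) = -1 → 4 * d.natAbs ∣ 8 → Odd a →
        ∃ p : ℕ, B < p ∧ p.Prime ∧ J(d | p) = -1 := by
      intro a ha hJ h8 hao
      obtain ⟨p, hpB, hp, hpa⟩ :=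
        Nat.forall_exists_prime_gt_and_modEq (max B 2) (by norm_num : (8 : ℕ) ≠ 0) ha
      refine ⟨p, by omega, hp, ?_⟩
      have hpo : Odd p := hp.odd_of_ne_two (by omega)
      rw [jacobiSym.mod_right d hpo, hpa.of_dvd h8, ← jacobiSym.mod_right d hao, hJ]
    have hk1 : k ≤ 1 := by
      by_contra! hk2
      have h22 : 2 * 2 ∣ d.natAbs := by
        rw [hk]; exact pow_dvd_pow 2 hk2
      exact absurd (Nat.isUnit_iff.mp (hd' 2 h22)) (by norm_num)
    have hcases : d = -1 ∨ d = 2 ∨ d = -2 := by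
      interval_cases k <;> omega
    rcases hcases with rfl | rfl | rfl
    · exact key 3 (by norm_num) (by rw [jacobiSym.at_neg_one (by decide)]; decide)
        (by decide) (by decide)
    · exact key 5 (by norm_num) (by rw [jacobiSym.at_two (by decide)]; decide)
        (by decide) (by decide)
    · exact key 5 (by norm_num) (by rw [jacobiSym.at_neg_two (by decide)]; decide)
        (by decide) (by decide)
  · have : Fact q.Prime := ⟨hq⟩
    obtain ⟨e, rfl⟩ : (q : ℤ) ∣ d := Int.natCast_dvd.mpr hqd
    have he0 : e ≠ 0 := by
      rintro rfl; exact hd.ne_zero (mul_zero _)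
    have hqe : ¬ q ∣ e.natAbs := by
      intro h
      have := hd q (mul_dvd_mul_left _ (Int.natCast_dvd.mpr h))
      exact (Nat.prime_iff_prime_int.mp hq).not_isUnit this
    have hq2 : q ≠ 2 := by
      rintro rfl; exact absurd hqo (by decide)
    have hcop : Nat.Coprime (8 * e.natAbs) q := by
      refine Nat.Coprime.mul_left ?_ ((hq.coprime_iff_not_dvd.mpr hqe).symm)
      exact Nat.Coprime.pow_left 3 ((Nat.coprime_primes Nat.prime_two hq).mpr hq2.symm)
    obtain ⟨x, hx⟩ := FiniteField.exists_nonsquare (F := ZMod q) (by rwa [ZMod.ringChar_zmod_n])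
    have hxv : ((x.val : ℕ) : ZMod q) = x := ZMod.natCast_zmod_val x
    obtain ⟨a, ha1, haq⟩ := Nat.chineseRemainder hcop 1 x.val
    have haq' : (a : ZMod q) = x := by
      rw [← hxv]; exact (ZMod.natCast_eq_natCast_iff _ _ _).mpr haq
    have hacop : a.Coprime (8 * e.natAbs * q) := by
      refine Nat.Coprime.mul_right ?_ ?_
      · have := ha1.gcd_eq
        simpa [Nat.Coprime] using this
      · refine ((hq.coprime_iff_not_dvd).mpr fun h => hx ?_).symm
        rw [← haq', (ZMod.natCast_eq_zero_iff a q).mpr h]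
        exact IsSquare.zero
    obtain ⟨p, hpB, hp, hpa⟩ := Nat.forall_exists_prime_gt_and_modEq (max B 2)
      (by have := hq.pos; positivity : 8 * e.natAbs * q ≠ 0) hacop
    refine ⟨p, by omega, hp, ?_⟩
    have hpo : Odd p := hp.odd_of_ne_two (by omega)
    have hp1 : p ≡ 1 [MOD 8 * e.natAbs] := (hpa.of_dvd (dvd_mul_right _ _)).trans ha1
    have hpq : (p : ZMod q) = x := by
      rw [← haq']; exact (ZMod.natCast_eq_natCast_iff _ _ _).mpr (hpa.of_dvd (dvd_mul_left _ _))
    have hp4 : p % 4 = 1 := hp1.of_dvd (Dvd.intro (2 * e.natAbs) (by ring) : 4 ∣ 8 * e.natAbs)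
    have hJe : J(e | p) = 1 := by
      rw [jacobiSym.mod_right e hpo,
        hp1.of_dvd (Dvd.intro 2 (by ring) : 4 * e.natAbs ∣ 8 * e.natAbs),
        ← jacobiSym.mod_right e odd_one, jacobiSym.one_right]
    have hJq : J(q | p) = -1 := by
      rw [jacobiSym.quadratic_reciprocity_one_mod_four' hqo hp4,
        ZMod.nonsquare_iff_jacobiSym_eq_neg_one]
      simpa [hpq] using hx
    rw [jacobiSym.mul_left, hJe, hJq, mul_one]

/-- An integer that is not a square is a non-residue, in the sense of the Jacobi symbol, at
arbitrarily large primes. -/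
lemma exists_prime_gt_jacobiSym_eq_neg_one {a : ℤ} (ha0 : a ≠ 0) (ha : ¬ IsSquare a) (B : ℕ) :
    ∃ p : ℕ, B < p ∧ p.Prime ∧ J(a | p) = -1 := by
  obtain ⟨d, s, hds, hd⟩ := Nat.sq_mul_squarefree a.natAbs
  have hs0 : s ≠ 0 := by
    rintro rfl
    exact ha0 (Int.natAbs_eq_zero.mp (by simpa using hds.symm))
  obtain ⟨D, hD, haD⟩ : ∃ D : ℤ, Squarefree D ∧ a = s ^ 2 * D := by
    rcases Int.natAbs_eq a with h | h
    · exact ⟨d, Int.squarefree_natCast.mpr hd, by rw [h, ← hds]; push_cast; ring⟩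
    · refine ⟨-d, ?_, by rw [h, ← hds]; push_cast; ring⟩
      rw [← Int.squarefree_natAbs]; simpa using hd
  have hD1 : D ≠ 1 := by
    rintro rfl
    exact ha ⟨s, by rw [haD]; ring⟩
  obtain ⟨p, hpB, hp, hJ⟩ :=
    exists_prime_gt_jacobiSym_eq_neg_one_of_squarefree hD hD1 (max B s)
  refine ⟨p, by omega, hp, ?_⟩
  have hsp : (s : ℤ).gcd p = 1 := by
    rw [Int.gcd_natCast_natCast]
    exact ((hp.coprime_iff_not_dvd).mpr fun h =>
      absurd (Nat.le_of_dvd (Nat.pos_of_ne_zero hs0) h) (by omega)).symm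
  rw [haD, jacobiSym.mul_left, jacobiSym.sq_one' hsp, hJ, one_mul]

lemma eq_one_of_squarefree_of_isSquare {n : ℤ} (hn : Squarefree n) (h : IsSquare n) : n = 1 := by
  obtain ⟨k, rfl⟩ := h
  exact Int.isUnit_mul_self (hn k dvd_rfl)

lemma eq_of_squarefree_of_isSquare_mul {m n : ℤ} (hm : Squarefree m) (hn : Squarefree n)
    (h : IsSquare (m * n)) : n = m := by
  obtain ⟨k, hk⟩ := h
  obtain ⟨t, rfl⟩ : m ∣ k :=
    (hm.dvd_pow_iff_dvd two_ne_zero).mp ⟨n, by rw [hk]; ring⟩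
  have hnt : n = t * t * m := mul_left_cancel₀ hm.ne_zero (by rw [hk]; ring)
  rw [hnt, Int.isUnit_mul_self (hn t ⟨m, hnt⟩), one_mul]

lemma jacobiSym_natMod {d : ℤ} {N b : ℕ} (hN : 4 * d.natAbs ∣ N) (hb : Odd b) :
    J(d | b % N) = J(d | b) := by
  have h4 : 4 ∣ N := (dvd_mul_right _ _).trans hN
  have ho : Odd (b % N) := by
    rw [Nat.odd_iff, Nat.mod_mod_of_dvd _ ((by norm_num : 2 ∣ 4).trans h4)]
    exact Nat.odd_iff.mp hb
  rw [jacobiSym.mod_right d ho, Nat.mod_mod_of_dvd _ hN, ← jacobiSym.mod_right d hb]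

lemma odd_val_of_four_dvd {N : ℕ} (h4 : 4 ∣ N) (u : (ZMod N)ˣ) : Odd (u : ZMod N).val := by
  have h := (ZMod.val_coe_unit_coprime u).coprime_dvd_right ((by norm_num : 2 ∣ 4).trans h4)
  exact Nat.coprime_two_right.mp h

/-- The quadratic character `b ↦ J(d | b)` on the units modulo a multiple of `4 * |d|`. -/
def jacobiUnitsHom (d : ℤ) (N : ℕ) (hN : 4 * d.natAbs ∣ N) (hN1 : N ≠ 1) :
    (ZMod N)ˣ →* ℤ where
  toFun u := J(d | (u : ZMod N).val)
  map_one' := by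
    rw [Units.val_one, ZMod.val_one'' hN1, jacobiSym.one_right]
  map_mul' u v := by
    have h4 : 4 ∣ N := (dvd_mul_right _ _).trans hN
    have hu := odd_val_of_four_dvd h4 u
    have hv := odd_val_of_four_dvd h4 v
    rw [Units.val_mul, ZMod.val_mul, jacobiSym_natMod hN (hu.mul hv),
      jacobiSym.mul_right' d hu.pos.ne' hv.pos.ne']

lemma sum_monoidHom_nonneg {G : Type*} [Group G] [Fintype G] (f : G →* ℤ) : 0 ≤ ∑ g, f g := by
  classical
  by_cases hf : f = 1
  · subst hf
    exact Finset.sum_nonneg fun _ _ => zero_le_one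
  · exact (sum_hom_units_eq_zero f hf).ge

/-- If `g₁`, `g₂` are sign characters that do not lie in `{1, f}`, they take the value `-1`
simultaneously somewhere on the kernel of `f`. -/
lemma exists_eq_one_and_eq_neg_one {G : Type*} [Group G] [Finite G] (f g₁ g₂ : G →* ℤ)
    (hg₁ : g₁ ≠ 1) (hg₂ : g₂ ≠ 1) (hfg₁ : f * g₁ ≠ 1) (hfg₂ : f * g₂ ≠ 1) :
    ∃ u, f u = 1 ∧ g₁ u = -1 ∧ g₂ u = -1 := by
  classical
  have := Fintype.ofFinite G
  by_contra! hno
  have sign (h : G →* ℤ) (u : G) : h u = 1 ∨ h u = -1 :=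
    Int.isUnit_iff.mp ((Group.isUnit u).map h)
  have hzero : ∑ u, (1 + f u) * (1 - g₁ u) * (1 - g₂ u) = 0 := by
    refine Finset.sum_eq_zero fun u _ => ?_
    rcases sign f u with h | h <;> rcases sign g₁ u with h' | h' <;>
      rcases sign g₂ u with h'' | h'' <;> simp_all
  have hexpand : ∑ u, (1 + f u) * (1 - g₁ u) * (1 - g₂ u) =
      Fintype.card G + ∑ u, f u - ∑ u, g₁ u - ∑ u, g₂ u + ∑ u, (g₁ * g₂) u - ∑ u, (f * g₁) u
        - ∑ u, (f * g₂) u + ∑ u, (f * g₁ * g₂) u := by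
    have hcard : (Fintype.card G : ℤ) = ∑ _u : G, 1 := by simp
    simp only [hcard, ← Finset.sum_add_distrib, ← Finset.sum_sub_distrib, MonoidHom.mul_apply]
    exact Finset.sum_congr rfl fun u _ => by ring
  rw [hzero, sum_hom_units_eq_zero g₁ hg₁, sum_hom_units_eq_zero g₂ hg₂,
    sum_hom_units_eq_zero _ hfg₁, sum_hom_units_eq_zero _ hfg₂] at hexpand
  have h1 := sum_monoidHom_nonneg f
  have h2 := sum_monoidHom_nonneg (g₁ * g₂)
  have h3 := sum_monoidHom_nonneg (f * g₁ * g₂)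
  have h4 : (0 : ℤ) < Fintype.card G := by exact_mod_cast Fintype.card_pos
  linarith

/-- Chebotarev step: given squarefree integers `m, n₁, n₂` with the classes of `n₁, n₂`
outside the subgroup of `ℚ*/(ℚ*)²` generated by `m`, there are infinitely many primes `w`
(avoiding `2 m n₁ n₂`) at which `m` is a square while `n₁` and `n₂` are non-squares. -/
theorem stmt_13 (m n₁ n₂ : ℤ) (hm : Squarefree m) (hn₁ : Squarefree n₁) (hn₂ : Squarefree n₂)
    (h₁ : n₁ ≠ 1 ∧ n₁ ≠ m) (h₂ : n₂ ≠ 1 ∧ n₂ ≠ m) :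
    {w : ℕ | w.Prime ∧ ¬ (w : ℤ) ∣ 2 * m * n₁ * n₂ ∧
      IsSquare ((m : ZMod w)) ∧ ¬ IsSquare ((n₁ : ZMod w)) ∧
      ¬ IsSquare ((n₂ : ZMod w))}.Infinite := by
  set N : ℕ := 4 * (m * n₁ * n₂).natAbs with hNdef
  have hN0 : N ≠ 0 := by
    have := hm.ne_zero
    have := hn₁.ne_zero
    have := hn₂.ne_zero
    positivity
  have : NeZero N := ⟨hN0⟩
  have hN1 : N ≠ 1 := by omega
  have hNm : 4 * m.natAbs ∣ N :=
    mul_dvd_mul_left 4 (Int.natAbs_dvd_natAbs.mpr ⟨n₁ * n₂, by ring⟩)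
  have hNn₁ : 4 * n₁.natAbs ∣ N :=
    mul_dvd_mul_left 4 (Int.natAbs_dvd_natAbs.mpr ⟨m * n₂, by ring⟩)
  have hNn₂ : 4 * n₂.natAbs ∣ N :=
    mul_dvd_mul_left 4 (Int.natAbs_dvd_natAbs.mpr ⟨m * n₁, by ring⟩)
  have hval {d : ℤ} (hd : 4 * d.natAbs ∣ N) {p : ℕ} (hp : p.Prime) (hp2 : p ≠ 2) (u : (ZMod N)ˣ)
      (hu : (p : ZMod N) = u) : J(d | p) = jacobiUnitsHom d N hd hN1 u := by
    change _ = J(d | (u : ZMod N).val)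
    rw [← hu, ZMod.val_natCast, jacobiSym_natMod hd (hp.odd_of_ne_two hp2)]
  have hlarge {a : ℤ} (ha0 : a ≠ 0) (ha : ¬ IsSquare a) :
      ∃ (p : ℕ) (u : (ZMod N)ˣ), p.Prime ∧ p ≠ 2 ∧ (p : ZMod N) = u ∧ J(a | p) = -1 := by
    obtain ⟨p, hpN, hp, hJ⟩ := exists_prime_gt_jacobiSym_eq_neg_one ha0 ha N
    have hcop : p.Coprime N := (hp.coprime_iff_not_dvd).mpr fun h =>
      absurd (Nat.le_of_dvd (Nat.pos_of_ne_zero hN0) h) (by omega)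
    exact ⟨p, ZMod.unitOfCoprime p hcop, hp, by omega, (ZMod.coe_unitOfCoprime p hcop).symm, hJ⟩
  have hne {d : ℤ} (hd : 4 * d.natAbs ∣ N) (hsq : Squarefree d) (hd1 : d ≠ 1) :
      jacobiUnitsHom d N hd hN1 ≠ 1 := by
    intro h
    obtain ⟨p, u, hp, hp2, hu, hJ⟩ := hlarge hsq.ne_zero
      fun hs => hd1 (eq_one_of_squarefree_of_isSquare hsq hs)
    rw [hval hd hp hp2 u hu, h] at hJ
    norm_num at hJ
  have hmulne {d : ℤ} (hd : 4 * d.natAbs ∣ N) (hsq : Squarefree d) (hdm : d ≠ m) :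
      jacobiUnitsHom m N hNm hN1 * jacobiUnitsHom d N hd hN1 ≠ 1 := by
    intro h
    obtain ⟨p, u, hp, hp2, hu, hJ⟩ := hlarge (mul_ne_zero hm.ne_zero hsq.ne_zero)
      fun hs => hdm (eq_of_squarefree_of_isSquare_mul hm hsq hs)
    rw [jacobiSym.mul_left, hval hNm hp hp2 u hu, hval hd hp hp2 u hu, ← MonoidHom.mul_apply,
      h] at hJ
    norm_num at hJ
  obtain ⟨u, hum, hu₁, hu₂⟩ := exists_eq_one_and_eq_neg_one _ _ _
    (hne hNn₁ hn₁ h₁.1) (hne hNn₂ hn₂ h₂.1) (hmulne hNn₁ hn₁ h₁.2) (hmulne hNn₂ hn₂ h₂.2)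
  refine Set.infinite_of_forall_exists_gt fun B => ?_
  obtain ⟨p, hpB, hp, hpu⟩ := Nat.forall_exists_prime_gt_and_eq_mod u.isUnit (max B (max N 2))
  have : Fact p.Prime := ⟨hp⟩
  have hp2 : p ≠ 2 := by omega
  refine ⟨p, ⟨hp, fun hdvd => ?_, ?_, ?_, ?_⟩, by omega⟩
  · have hpN : p ∣ N := by
      rw [← Int.natCast_dvd_natCast, hNdef]
      push_cast
      rw [← abs_of_pos (by norm_num : (0 : ℤ) < 4), ← abs_mul, dvd_abs]
      exact hdvd.trans ⟨2, by ring⟩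
    exact absurd (Nat.le_of_dvd (Nat.pos_of_ne_zero hN0) hpN) (by omega)
  · refine ZMod.isSquare_of_jacobiSym_eq_one ?_
    rw [hval hNm hp hp2 u hpu, hum]
  · rw [← ZMod.nonsquare_iff_jacobiSym_eq_neg_one, hval hNn₁ hp hp2 u hpu, hu₁]
  · rw [← ZMod.nonsquare_iff_jacobiSym_eq_neg_one, hval hNn₂ hp hp2 u hpu, hu₂]
end
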